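/- Let λ > 0, γ ∈ (0,1), α ≥ 0, y ∈ ℝ^n, and let x* be a global minimizer of the proximal objective f_{γ,α}(x) = γ(‖x‖₁ − α‖x‖₂) + (1−γ)‖x‖₂² + (1/(2λ))‖x − y‖₂², with x* ≠ 0. Then for every x ∈ ℝ^n, f_{γ,α}(x*) − f_{γ,α}(x) ≤ min( (1/2)(γα/‖x*‖₂ − 1/λ − (1−γ)), 0 )·‖x* − x‖₂². -/

import Mathlib

/-- The ℓ¹-norm of a vector in ℝ^n. -/
noncomputable def norm1 {n : ℕ} (x : Fin n → ℝ) : ℝ := ∑ i, |x i|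

/-- The Euclidean (ℓ²) norm of a vector in ℝ^n. -/
noncomputable def norm2 {n : ℕ} (x : Fin n → ℝ) : ℝ := Real.sqrt (∑ i, (x i) ^ 2)

/-- The DCEN proximal objective
  f_{γ,α}(x) = γ(‖x‖₁ − α‖x‖₂) + (1−γ)‖x‖₂² + (1/(2λ))‖x − y‖₂². -/
noncomputable def proxObj {n : ℕ} (lam γ α : ℝ) (y x : Fin n → ℝ) : ℝ :=
  γ * (norm1 x - α * norm2 x) + (1 - γ) * (norm2 x) ^ 2
    + (1 / (2 * lam)) * (norm2 (x - y)) ^ 2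

theorem norm2_nonneg {n : ℕ} (u : Fin n → ℝ) : 0 ≤ norm2 u := Real.sqrt_nonneg _

theorem norm2_sq {n : ℕ} (u : Fin n → ℝ) : norm2 u ^ 2 = ∑ i, u i ^ 2 :=
  Real.sq_sqrt (Finset.sum_nonneg fun _ _ => sq_nonneg _)

theorem norm2_pos {n : ℕ} {u : Fin n → ℝ} (hu : u ≠ 0) : 0 < norm2 u := by
  obtain ⟨i, hi⟩ := Function.ne_iff.mp hu
  exact Real.sqrt_pos.mpr <| Finset.sum_pos' (fun _ _ => sq_nonneg _)
    ⟨i, Finset.mem_univ i, sq_pos_of_ne_zero hi⟩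

theorem norm2_smul_sq {n : ℕ} (t : ℝ) (u : Fin n → ℝ) :
    norm2 (t • u) ^ 2 = t ^ 2 * norm2 u ^ 2 := by
  simp only [norm2_sq, Pi.smul_apply, smul_eq_mul, mul_pow, Finset.mul_sum]

theorem norm2_sq_convex_comb {n : ℕ} (t : ℝ) (u v : Fin n → ℝ) :
    norm2 ((1 - t) • u + t • v) ^ 2
      = (1 - t) * norm2 u ^ 2 + t * norm2 v ^ 2 - t * (1 - t) * norm2 (u - v) ^ 2 := by
  simp only [norm2_sq, Finset.mul_sum, ← Finset.sum_add_distrib, ← Finset.sum_sub_distrib]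
  refine Finset.sum_congr rfl fun i _ => ?_
  simp only [Pi.add_apply, Pi.smul_apply, Pi.sub_apply, smul_eq_mul]
  ring

theorem norm1_convex_comb_le {n : ℕ} {t : ℝ} (h0 : 0 ≤ t) (h1 : t ≤ 1) (u v : Fin n → ℝ) :
    norm1 ((1 - t) • u + t • v) ≤ (1 - t) * norm1 u + t * norm1 v := by
  simp only [norm1, Finset.mul_sum, ← Finset.sum_add_distrib]
  refine Finset.sum_le_sum fun i _ => ?_
  simpa [abs_mul, abs_of_nonneg h0, abs_of_nonneg (sub_nonneg.mpr h1)]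
    using abs_add_le ((1 - t) * u i) (t * v i)

/-- The reverse triangle inequality, squared. -/
theorem sq_norm2_sub_norm2_le {n : ℕ} (u v : Fin n → ℝ) :
    (norm2 u - norm2 v) ^ 2 ≤ norm2 (u - v) ^ 2 := by
  have hcs : ∑ i, u i * v i ≤ norm2 u * norm2 v := Real.sum_mul_le_sqrt_mul_sqrt _ _ _
  have hexp : norm2 (u - v) ^ 2 = norm2 u ^ 2 + norm2 v ^ 2 - 2 * ∑ i, u i * v i := by
    simp only [norm2_sq, Finset.mul_sum, ← Finset.sum_add_distrib, ← Finset.sum_sub_distrib]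
    refine Finset.sum_congr rfl fun i _ => ?_
    simp only [Pi.sub_apply]
    ring
  rw [hexp]
  linarith [sub_sq (norm2 u) (norm2 v)]

theorem nonneg_of_forall_nonneg_add_mul {P Q : ℝ}
    (h : ∀ t : ℝ, 0 < t → t ≤ 1 → 0 ≤ P + t * Q) : 0 ≤ P := by
  have hlim : Filter.Tendsto (fun t : ℝ => P + t * Q) (nhdsWithin 0 (Set.Ioi 0)) (nhds P) := by
    have hc : Continuous fun t : ℝ => P + t * Q := by fun_prop
    simpa using (hc.tendsto 0).mono_left nhdsWithin_le_nhds
  refine ge_of_tendsto hlim ?_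
  filter_upwards [Ioc_mem_nhdsGT (zero_lt_one' ℝ)] with t ht using h t ht.1 ht.2

/-- Quadratic growth of the proximal objective around a nonzero global minimizer. -/
theorem proxObj_sub_le_of_isMin {n : ℕ} {lam γ α : ℝ} (hγ : 0 ≤ γ) (hα : 0 ≤ α)
    {y xstar : Fin n → ℝ}
    (hmin : ∀ x : Fin n → ℝ, proxObj lam γ α y xstar ≤ proxObj lam γ α y x)
    (hne : xstar ≠ 0) (x : Fin n → ℝ) :
    proxObj lam γ α y xstar - proxObj lam γ α y x
      ≤ (γ * α / (2 * norm2 xstar) - 1 / (2 * lam) - (1 - γ)) * norm2 (xstar - x) ^ 2 := by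
  have hr : 0 < norm2 xstar := norm2_pos hne
  set r := norm2 xstar with hrdef
  set D := norm2 (xstar - x) ^ 2 with hD
  set κ := γ * α / (2 * r) with hκ
  set μ := 1 / (2 * lam) with hμ
  have hκ0 : 0 ≤ κ := by positivity
  have hk : γ * α = 2 * κ * r := by rw [hκ]; field_simp
  have hP : 0 ≤ γ * norm1 x - γ * norm1 xstar + (1 - γ - κ) * (norm2 x ^ 2 - r ^ 2 - D)
      + μ * (norm2 (x - y) ^ 2 - norm2 (xstar - y) ^ 2 - D) := by
    refine nonneg_of_forall_nonneg_add_mul (Q := (1 - γ + μ) * D) fun t ht ht1 => ?_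
    set z := (1 - t) • xstar + t • x with hz
    have hmz := hmin z
    have h1 := mul_le_mul_of_nonneg_left (norm1_convex_comb_le ht.le ht1 xstar x) hγ
    have h2 := norm2_sq_convex_comb t xstar x
    have h3 := norm2_sq_convex_comb t (xstar - y) (x - y)
    have hzy : (1 - t) • (xstar - y) + t • (x - y) = z - y := by
      rw [hz]; module
    have h4 : (norm2 z - r) ^ 2 ≤ t ^ 2 * D := by
      have hzx : z - xstar = (-t) • (xstar - x) := by rw [hz]; module
      have := sq_norm2_sub_norm2_le z xstar
      rwa [hzx, norm2_smul_sq, neg_sq] at this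
    rw [hzy, sub_sub_sub_cancel_right] at h3
    rw [← hz, ← hrdef, ← hD] at h2
    rw [← hz] at h1
    rw [← hD] at h3
    have h5 := mul_le_mul_of_nonneg_left h4 hκ0
    simp only [proxObj, ← hrdef, ← hμ] at hmz
    rw [h3] at hmz
    have h6 : γ * α * norm2 z = κ * (norm2 z ^ 2 + r ^ 2) - κ * (norm2 z - r) ^ 2 := by
      rw [hk]; ring
    have h7 : γ * α * r = 2 * κ * r ^ 2 := by rw [hk]; ring
    rw [h2] at h6 hmz
    refine nonneg_of_mul_nonneg_right (a := t) ?_ ht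
    linarith
  have h6 : γ * α * norm2 x = κ * (norm2 x ^ 2 + r ^ 2) - κ * (norm2 x - r) ^ 2 := by
    rw [hk]; ring
  have h7 : γ * α * r = 2 * κ * r ^ 2 := by rw [hk]; ring
  have h8 : 0 ≤ κ * (norm2 x - r) ^ 2 := by positivity
  simp only [proxObj, ← hrdef, ← hμ]
  linarith

/-- If x* ≠ 0 is a global minimizer of the DCEN proximal objective, then
  for every x, f_{γ,α}(x*) − f_{γ,α}(x) ≤ min((1/2)(γα/‖x*‖₂ − 1/λ − (1−γ)), 0)·‖x* − x‖₂². -/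
theorem stmt15 {n : ℕ} (lam γ α : ℝ) (hlam : 0 < lam)
    (hγ : 0 < γ) (hγ1 : γ < 1) (hα : 0 ≤ α)
    (y : Fin n → ℝ) (xstar : Fin n → ℝ)
    (hmin : ∀ x : Fin n → ℝ, proxObj lam γ α y xstar ≤ proxObj lam γ α y x)
    (hne : xstar ≠ 0) :
    ∀ x : Fin n → ℝ,
      proxObj lam γ α y xstar - proxObj lam γ α y x
        ≤ min ((1 / 2) * (γ * α / norm2 xstar - 1 / lam - (1 - γ))) 0
            * (norm2 (xstar - x)) ^ 2 := by
  intro x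
  have hD := sq_nonneg (norm2 (xstar - x))
  rcases min_choice ((1 / 2) * (γ * α / norm2 xstar - 1 / lam - (1 - γ))) 0 with h | h <;> rw [h]
  · refine (proxObj_sub_le_of_isMin hγ.le hα hmin hne x).trans
      (mul_le_mul_of_nonneg_right ?_ hD)
    have h1 : γ * α / (2 * norm2 xstar) = (1 / 2) * (γ * α / norm2 xstar) := by ring
    have h2 : 1 / (2 * lam) = (1 / 2) * (1 / lam) := by ring
    linarith
  · simpa using hmin x
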